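/- arXiv:1010.0628 — 2 statements merged into one kernel-verified Lean document; each statement's English description precedes it below -/
import Mathlib

section
/- For every ε > 0 and every positive integer L there is a positive integer M (with M ≥ L) such that for all n ≥ M, every nonzero real n × n matrix A (not necessarily symmetric) has a symmetric (ε)-regular block partition (𝒫,𝒫) with exceptional set V₀ such that L ≤ |𝒫| ≤ M. -/
open Finset

/-- `w_A(X,Y)`: the sum of the entries of `A` over the block `X × Y`. -/
def wSum {V W : Type*} (A : V → W → ℝ) (X : Finset V) (Y : Finset W) : ℝ :=
  ∑ x ∈ X, ∑ y ∈ Y, A x y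

/-- `d_A(X,Y)`: the density of the block `X × Y`. -/
noncomputable def dens {V W : Type*} (A : V → W → ℝ) (X : Finset V) (Y : Finset W) : ℝ :=
  wSum A X Y / ((X.card : ℝ) * (Y.card : ℝ))

/-- `‖A‖`: the sum of the absolute values of the entries of `A`. -/
def matNorm {V W : Type*} [Fintype V] [Fintype W] (A : V → W → ℝ) : ℝ :=
  ∑ x : V, ∑ y : W, |A x y|

/-- The normalized matrix `A* = (|V||W|/‖A‖) · A`. -/
noncomputable def normalizeMat {V W : Type*} [Fintype V] [Fintype W] (A : V → W → ℝ) :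
    V → W → ℝ :=
  fun x y => ((Fintype.card V : ℝ) * (Fintype.card W : ℝ) / matNorm A) * A x y

/-- The submatrix `(X, Y)` of `A` is `ε`-regular. -/
def EpsRegular {V W : Type*} (A : V → W → ℝ) (ε : ℝ) (X : Finset V) (Y : Finset W) : Prop :=
  ∀ X' ⊆ X, ∀ Y' ⊆ Y, ε * X.card ≤ X'.card → ε * Y.card ≤ Y'.card →
    |dens A X' Y' - dens A X Y| ≤ ε

/-- A partition of `V` with an exceptional set and `k` non-exceptional classes is encoded
as a map `p : V → Fin (k+1)`; class `0` is the exceptional set, and `classOf p i` is the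
`i`-th class. -/
def classOf {V : Type*} [Fintype V] {k : ℕ} (p : V → Fin (k + 1)) (i : Fin (k + 1)) :
    Finset V :=
  Finset.univ.filter fun x => p x = i

/-- The partition encoded by `p` (with exceptional class `0`) is balanced: all
non-exceptional classes have equal size. -/
def BalancedP {V : Type*} [Fintype V] {k : ℕ} (p : V → Fin (k + 1)) : Prop :=
  ∀ i j : Fin (k + 1), i ≠ 0 → j ≠ 0 → (classOf p i).card = (classOf p j).card

open Classical in
/-- `(p, q)` is an `ε`-regular block partition of `A` with exceptional sets the classes `0`:
it is balanced, the exceptional sets have size `< ε|V|`, `< ε|W|`, and all but at most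
`ε·k·l` of the non-exceptional blocks are `ε`-regular. -/
def EpsRegularPartition {V W : Type*} [Fintype V] [Fintype W] {k l : ℕ}
    (A : V → W → ℝ) (ε : ℝ) (p : V → Fin (k + 1)) (q : W → Fin (l + 1)) : Prop :=
  BalancedP p ∧ BalancedP q ∧
  ((classOf p 0).card : ℝ) < ε * Fintype.card V ∧
  ((classOf q 0).card : ℝ) < ε * Fintype.card W ∧
  ((((Finset.univ : Finset (Fin (k + 1) × Fin (l + 1))).filter fun ij =>
      ij.1 ≠ 0 ∧ ij.2 ≠ 0 ∧ ¬ EpsRegular A ε (classOf p ij.1) (classOf q ij.2)).card : ℝ)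
    ≤ ε * k * l)

/-- `(p, q)` is an `(ε)`-regular block partition of `A`: an `ε`-regular block partition of
the normalized matrix `A*`. -/
noncomputable def ScaledEpsRegularPartition {V W : Type*} [Fintype V] [Fintype W] {k l : ℕ}
    (A : V → W → ℝ) (ε : ℝ) (p : V → Fin (k + 1)) (q : W → Fin (l + 1)) : Prop :=
  EpsRegularPartition (normalizeMat A) ε p q

/-- The dual energy of a test function `s` against the matrix `A`. -/
def testEnergy {V W : Type*} [Fintype V] [Fintype W] (A s : V → W → ℝ) : ℝ :=
  ∑ x, ∑ y, (2 * s x y * A x y - s x y ^ 2)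

/-- `s` is constant in each variable along the non-exceptional classes of `p`. -/
def ConstOnClasses {V : Type*} {k : ℕ} (p : V → Fin (k + 1)) (s : V → V → ℝ) : Prop :=
  (∀ x x' y, p x = p x' → p x ≠ 0 → s x y = s x' y) ∧
    ∀ x y y', p y = p y' → p y ≠ 0 → s x y = s x y'

lemma EpsRegular.mono {V W : Type*} {A : V → W → ℝ} {ε δ : ℝ} (h : ε ≤ δ) {X : Finset V}
    {Y : Finset W} (hr : EpsRegular A ε X Y) : EpsRegular A δ X Y := by
  intro X' hX Y' hY h1 h2
  refine (hr X' hX Y' hY (le_trans ?_ h1) (le_trans ?_ h2)).trans h <;> gcongr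

lemma EpsRegularPartition.mono {V W : Type*} [Fintype V] [Fintype W] {k l : ℕ}
    {A : V → W → ℝ} {ε δ : ℝ} (h : ε ≤ δ) {p : V → Fin (k + 1)} {q : W → Fin (l + 1)}
    (hr : EpsRegularPartition A ε p q) : EpsRegularPartition A δ p q := by
  classical
  obtain ⟨h1, h2, h3, h4, h5⟩ := hr
  refine ⟨h1, h2, h3.trans_le (by gcongr), h4.trans_le (by gcongr), ?_⟩
  refine le_trans (Nat.cast_le.mpr (card_le_card ?_)) (h5.trans (by gcongr))
  intro ij hij
  simp only [mem_filter, mem_univ, true_and] at hij ⊢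
  exact ⟨hij.1, hij.2.1, fun hh => hij.2.2 (hh.mono h)⟩

lemma matNorm_normalizeMat {V W : Type*} [Fintype V] [Fintype W] {A : V → W → ℝ}
    (hA : A ≠ 0) :
    matNorm (normalizeMat A) = (Fintype.card V : ℝ) * Fintype.card W := by
  have hpos : 0 < matNorm A := by
    have hne : ∃ x y, A x y ≠ 0 := by
      by_contra! h
      exact hA (funext fun x => funext fun y => h x y)
    obtain ⟨x, y, hxy⟩ := hne
    have h1 : |A x y| ≤ ∑ y, |A x y| :=
      single_le_sum (f := fun y => |A x y|) (fun _ _ => abs_nonneg _) (mem_univ y)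
    have h2 : ∑ y, |A x y| ≤ matNorm A :=
      single_le_sum (f := fun x => ∑ y, |A x y|)
        (fun _ _ => sum_nonneg fun _ _ => abs_nonneg _) (mem_univ x)
    have := abs_pos.mpr hxy
    linarith
  have : matNorm (normalizeMat A)
      = ((Fintype.card V : ℝ) * Fintype.card W / matNorm A) * matNorm A := by
    conv_rhs => rw [matNorm]
    simp only [mul_sum]
    unfold matNorm normalizeMat
    refine sum_congr rfl fun x _ => sum_congr rfl fun y _ => ?_
    rw [abs_mul, abs_of_nonneg (div_nonneg (by positivity) hpos.le)]
    rfl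
  rw [this]
  field_simp

lemma testEnergy_le {V W : Type*} [Fintype V] [Fintype W] {A s : V → W → ℝ} {T : ℝ}
    (hs : ∀ x y, |s x y| ≤ T) : testEnergy A s ≤ 2 * T * matNorm A := by
  unfold testEnergy matNorm
  simp only [mul_sum]
  refine sum_le_sum fun x _ => sum_le_sum fun y _ => ?_
  have h1 : s x y * A x y ≤ T * |A x y| := by
    refine (le_abs_self _).trans ?_
    rw [abs_mul]
    exact mul_le_mul_of_nonneg_right (hs x y) (abs_nonneg _)
  nlinarith [sq_nonneg (s x y)]

lemma dens_mul_card {V W : Type*} (A : V → W → ℝ) {X : Finset V} {Y : Finset W}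
    (hX : X.Nonempty) (hY : Y.Nonempty) :
    dens A X Y * ((X.card : ℝ) * Y.card) = wSum A X Y := by
  have h1 : (X.card : ℝ) ≠ 0 := by simpa using hX.ne_empty
  have h2 : (Y.card : ℝ) ≠ 0 := by simpa using hY.ne_empty
  unfold _root_.dens
  field_simp

/-- On an irregular block the density can be perturbed on a sub-block so that the test energy
beats every constant. -/
lemma exists_perturbation {V W : Type*} [DecidableEq V] [DecidableEq W] {A : V → W → ℝ}
    {ε : ℝ} (hε : 0 < ε) {X : Finset V} {Y : Finset W} (hX : X.Nonempty) (hY : Y.Nonempty)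
    (hr : ¬ EpsRegular A ε X Y) :
    ∃ (X' : Finset V) (Y' : Finset W) (τ : ℝ), |τ| ≤ ε ∧ ∀ σ : ℝ,
      ∑ x ∈ X, ∑ y ∈ Y, (2 * σ * A x y - σ ^ 2) + ε ^ 4 * (X.card * Y.card) ≤
        ∑ x ∈ X, ∑ y ∈ Y, (2 * (dens A X Y + if x ∈ X' ∧ y ∈ Y' then τ else 0) * A x y
          - (dens A X Y + if x ∈ X' ∧ y ∈ Y' then τ else 0) ^ 2) := by
  unfold EpsRegular at hr
  push Not at hr
  obtain ⟨X', hX', Y', hY', h1, h2, h3⟩ := hr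
  have hXc : (0 : ℝ) < X.card := by exact_mod_cast hX.card_pos
  have hYc : (0 : ℝ) < Y.card := by exact_mod_cast hY.card_pos
  have hX'c : (0 : ℝ) < X'.card := lt_of_lt_of_le (by positivity) h1
  have hY'c : (0 : ℝ) < Y'.card := lt_of_lt_of_le (by positivity) h2
  have hX'n : X'.Nonempty := card_pos.mp (by exact_mod_cast hX'c)
  have hY'n : Y'.Nonempty := card_pos.mp (by exact_mod_cast hY'c)
  have hw := dens_mul_card A hX hY
  have hw' := dens_mul_card A hX'n hY'n
  set d := dens A X Y
  set d' := dens A X' Y'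
  obtain ⟨τ, hτ, hτ2, hgain⟩ : ∃ τ : ℝ, |τ| ≤ ε ∧ τ ^ 2 = ε ^ 2 ∧ ε ^ 2 ≤ τ * (d' - d) := by
    rcases le_total 0 (d' - d) with h | h
    · rw [abs_of_nonneg h] at h3
      exact ⟨ε, (abs_of_pos hε).le, rfl, by nlinarith⟩
    · rw [abs_of_nonpos h] at h3
      exact ⟨-ε, by rw [abs_neg, abs_of_pos hε], by ring, by nlinarith⟩
  refine ⟨X', Y', τ, hτ, fun σ => ?_⟩
  have hconst : ∀ c : ℝ, ∑ x ∈ X, ∑ y ∈ Y, (2 * c * A x y - c ^ 2)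
      = 2 * c * wSum A X Y - c ^ 2 * (X.card * Y.card) := by
    intro c
    simp only [sum_sub_distrib, ← mul_sum, sum_const, nsmul_eq_mul, wSum]
    ring
  have hsub : ∑ x ∈ X, ∑ y ∈ Y, (if x ∈ X' ∧ y ∈ Y' then
        2 * τ * A x y - (2 * d * τ + τ ^ 2) else 0)
      = 2 * τ * wSum A X' Y' - (2 * d * τ + τ ^ 2) * (X'.card * Y'.card) := by
    simp only [ite_and, ← ite_sum_zero, sum_ite_mem,
      inter_eq_right.mpr hX', inter_eq_right.mpr hY']
    simp only [sum_sub_distrib, ← mul_sum, sum_const, nsmul_eq_mul, wSum]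
    ring
  have hsplit : ∑ x ∈ X, ∑ y ∈ Y, (2 * (d + if x ∈ X' ∧ y ∈ Y' then τ else 0) * A x y
          - (d + if x ∈ X' ∧ y ∈ Y' then τ else 0) ^ 2)
      = ∑ x ∈ X, ∑ y ∈ Y, (2 * d * A x y - d ^ 2)
        + ∑ x ∈ X, ∑ y ∈ Y, (if x ∈ X' ∧ y ∈ Y' then
          2 * τ * A x y - (2 * d * τ + τ ^ 2) else 0) := by
    simp only [← sum_add_distrib]
    refine sum_congr rfl fun x _ => sum_congr rfl fun y _ => ?_
    split_ifs <;> ring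
  rw [hsplit, hconst, hconst, hsub, ← hw, ← hw', hτ2]
  have hc : ε ^ 2 * ((X.card : ℝ) * Y.card) ≤ X'.card * Y'.card := by
    calc ε ^ 2 * ((X.card : ℝ) * Y.card) = (ε * X.card) * (ε * Y.card) := by ring
      _ ≤ _ := by gcongr
  have hc2 : ε ^ 4 * ((X.card : ℝ) * Y.card) ≤ ε ^ 2 * (X'.card * Y'.card) := by
    calc ε ^ 4 * ((X.card : ℝ) * Y.card) = ε ^ 2 * (ε ^ 2 * ((X.card : ℝ) * Y.card)) := by ring
      _ ≤ _ := by gcongr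
  have hg : ε ^ 2 * ((X'.card : ℝ) * Y'.card) ≤ τ * (d' - d) * (X'.card * Y'.card) := by
    gcongr
  have hsq : 0 ≤ (d - σ) ^ 2 * ((X.card : ℝ) * Y.card) := by positivity
  nlinarith

lemma sum_eq_sum_classOf {V : Type*} [Fintype V] {k : ℕ} (p : V → Fin (k + 1))
    (f : V → V → ℝ) :
    ∑ x, ∑ y, f x y
      = ∑ ij : Fin (k + 1) × Fin (k + 1),
        ∑ x ∈ classOf p ij.1, ∑ y ∈ classOf p ij.2, f x y := by
  rw [Fintype.sum_prod_type, ← sum_fiberwise univ p]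
  refine sum_congr rfl fun i _ => ?_
  change _ = ∑ j, ∑ x ∈ classOf p i, ∑ y ∈ classOf p j, f x y
  rw [sum_comm (s := univ) (t := classOf p i)]
  exact sum_congr rfl fun x _ => (sum_fiberwise univ p (f x)).symm

/-- Greedy chopping of the fibres of `g` on `U` into classes of size `m`. -/
lemma exists_chop {V K : Type*} [Fintype V] [DecidableEq V] [Fintype K] [DecidableEq K]
    (g : V → K) {m : ℕ} (hm : 0 < m) (U : Finset V) :
    ∃ (k : ℕ) (q : V → Fin (k + 1)), (∀ i, i ≠ 0 → (classOf q i).card = m) ∧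
      (∀ x, x ∉ U → q x = 0) ∧ (∀ x y, q x = q y → q x ≠ 0 → g x = g y) ∧
      (U.filter fun x => q x = 0).card ≤ Fintype.card K * m := by
  induction U using Finset.strongInduction with
  | H U ih =>
    by_cases h : ∃ a, m ≤ (U.filter fun x => g x = a).card
    · obtain ⟨a, ha⟩ := h
      obtain ⟨S, hS, hSm⟩ := exists_subset_card_eq ha
      have hSU : S ⊆ U := hS.trans (filter_subset _ _)
      have hSn : S.Nonempty := card_pos.mp (by omega)
      have hgS : ∀ x ∈ S, g x = a := fun x hx => (mem_filter.mp (hS hx)).2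
      obtain ⟨k, q, h1, h2, h3, h4⟩ := ih (U \ S) (sdiff_ssubset hSU hSn)
      have hqS : ∀ x ∈ S, q x = 0 := fun x hx => h2 x (by simp [hx])
      refine ⟨k + 1, fun x => if x ∈ S then Fin.last (k + 1) else (q x).castSucc,
        ?_, ?_, ?_, ?_⟩
      · intro i hi
        induction i using Fin.lastCases with
        | last =>
          rw [← hSm]
          congr 1
          ext x
          by_cases hx : x ∈ S <;> simp [classOf, hx]
        | cast i =>
          have hi0 : i ≠ 0 := by rintro rfl; exact hi rfl
          rw [← h1 i hi0]
          congr 1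
          ext x
          by_cases hx : x ∈ S
          · simp [classOf, hx, hqS x hx, hi0.symm, (Fin.castSucc_ne_last i).symm]
          · simp [classOf, hx]
      · intro x hx
        have hxS : x ∉ S := fun h => hx (hSU h)
        simp [hxS, h2 x (by simp [hx])]
      · intro x y hxy hx0
        by_cases hx : x ∈ S <;> by_cases hy : y ∈ S
        · rw [hgS x hx, hgS y hy]
        · simp [hx, hy, (Fin.castSucc_ne_last (q y)).symm] at hxy
        · simp [hx, hy] at hxy
        · simp only [hx, hy, if_false, Fin.castSucc_inj] at hxy hx0
          refine h3 x y hxy fun h0 => hx0 ?_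
          rw [h0]; rfl
      · refine le_trans (card_le_card ?_) h4
        intro x hx
        simp only [mem_filter, mem_sdiff] at hx ⊢
        by_cases hxS : x ∈ S
        · simp [hxS, Fin.ext_iff] at hx
        · refine ⟨⟨hx.1, hxS⟩, ?_⟩
          have := hx.2
          simpa only [hxS, if_false, Fin.castSucc_eq_zero_iff] using this
    · push Not at h
      refine ⟨0, fun _ => 0, fun i hi => absurd (Fin.fin_one_eq_zero i) hi, fun _ _ => rfl,
        fun x y _ hx => absurd rfl hx, ?_⟩
      refine (card_le_card (filter_subset _ _)).trans ?_
      rw [card_eq_sum_card_fiberwise (f := g) (t := univ) (fun _ _ => by simp)]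
      refine (sum_le_card_nsmul _ _ m fun a _ => (h a).le).trans ?_
      simp

lemma card_classes {V : Type*} [Fintype V] {k m : ℕ} {p : V → Fin (k + 1)}
    (hp : ∀ i, i ≠ 0 → (classOf p i).card = m) :
    Fintype.card V = (classOf p 0).card + k * m := by
  classical
  rw [← card_univ, card_eq_sum_card_fiberwise (f := p) (t := univ) (fun _ _ => by simp),
    Fin.sum_univ_succ]
  congr 1
  exact (sum_congr rfl fun i _ => hp (Fin.succ i) (Fin.succ_ne_zero i)).trans (by simp)

/-- Chopping into about `R` classes while losing at most a `β` fraction of the vertices. -/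
lemma exists_refinement {V K : Type*} [Fintype V] [DecidableEq V] [Fintype K] [DecidableEq K]
    (g : V → K) {L R : ℕ} {β b : ℝ} (hL : 0 < L) (hLR : 2 * L ≤ R)
    (hRn : R ≤ Fintype.card V) (hK : (Fintype.card K : ℝ) ≤ β * R) (U : Finset V)
    (hU : ((univ.filter fun x => x ∉ U).card : ℝ) ≤ b)
    (hb : b + β * Fintype.card V ≤ Fintype.card V / 2) :
    ∃ (k : ℕ) (q : V → Fin (k + 1)), L ≤ k ∧ k ≤ 2 * R ∧ BalancedP q ∧
      ((classOf q 0).card : ℝ) ≤ b + β * Fintype.card V ∧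
      (∀ x, x ∉ U → q x = 0) ∧ (∀ x y, q x = q y → q x ≠ 0 → g x = g y) := by
  set n := Fintype.card V with hn
  have hR : 0 < R := by omega
  set m := n / R with hmdef
  have hm : 0 < m := Nat.div_pos hRn hR
  have hmR : R * m ≤ n := Nat.mul_div_le n R
  have hmR' : n < R * (m + 1) := by
    have := Nat.lt_mul_div_succ n hR
    simpa using this
  obtain ⟨k, q, h1, h2, h3, h4⟩ := exists_chop g hm U
  have hcard := card_classes h1
  rw [← hn] at hcard
  have hβ : 0 ≤ β := by
    have h0 : (0 : ℝ) ≤ β * R := (Nat.cast_nonneg _).trans hK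
    have : (0 : ℝ) < R := by exact_mod_cast hR
    exact nonneg_of_mul_nonneg_left h0 this
  have hKm : ((Fintype.card K * m : ℕ) : ℝ) ≤ β * n := by
    push_cast
    calc (Fintype.card K : ℝ) * m ≤ β * R * m := by gcongr
      _ = β * ((R * m : ℕ) : ℝ) := by push_cast; ring
      _ ≤ β * n := by gcongr
  have h0 : ((classOf q 0).card : ℝ) ≤ b + β * n := by
    have hsub : classOf q 0 ⊆ (univ.filter fun x => x ∉ U) ∪ U.filter fun x => q x = 0 := by
      intro x hx
      simp only [classOf, mem_filter, mem_univ, true_and, mem_union] at hx ⊢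
      tauto
    have := (card_le_card hsub).trans (card_union_le _ _)
    have h5 : ((classOf q 0).card : ℝ) ≤ ((univ.filter fun x => x ∉ U).card : ℝ)
        + ((U.filter fun x => q x = 0).card : ℝ) := by exact_mod_cast this
    have h6 : ((U.filter fun x => q x = 0).card : ℝ) ≤ ((Fintype.card K * m : ℕ) : ℝ) := by
      exact_mod_cast h4
    linarith
  have hkm : n ≤ 2 * (k * m) := by
    have h5 : ((classOf q 0).card : ℝ) ≤ n / 2 := h0.trans hb
    have h6 : 2 * (classOf q 0).card ≤ n := by
      have : (2 : ℝ) * (classOf q 0).card ≤ n := by linarith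
      exact_mod_cast this
    omega
  refine ⟨k, q, ?_, ?_, ?_, h0, h2, h3⟩
  · have : m * R ≤ m * (2 * k) := by nlinarith
    have := Nat.le_of_mul_le_mul_left this hm
    omega
  · have : m * k ≤ m * (2 * R) := by nlinarith
    exact Nat.le_of_mul_le_mul_left this hm
  · intro i j hi hj
    rw [h1 i hi, h1 j hj]

/-- Few blocks have density exceeding `D` when the total mass is at most `n ^ 2`. -/
lemma card_dense_blocks_le {V : Type*} [Fintype V] {k m : ℕ} {A : V → V → ℝ}
    (hA : matNorm A ≤ (Fintype.card V : ℝ) ^ 2) {p : V → Fin (k + 1)}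
    (hp : ∀ i, i ≠ 0 → (classOf p i).card = m) (hm : 0 < m)
    (hn : (Fintype.card V : ℝ) ≤ 2 * (k * m)) {D : ℝ} (S : Finset (Fin (k + 1) × Fin (k + 1)))
    (hS : ∀ ij ∈ S, ij.1 ≠ 0 ∧ ij.2 ≠ 0 ∧
      D < |dens A (classOf p ij.1) (classOf p ij.2)|) :
    (S.card : ℝ) * D ≤ 4 * k ^ 2 := by
  have hm' : (0 : ℝ) < m := by exact_mod_cast hm
  have h1 : (S.card : ℝ) * (D * m ^ 2) ≤ matNorm A := by
    rw [matNorm, sum_eq_sum_classOf p]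
    calc (S.card : ℝ) * (D * m ^ 2) = ∑ ij ∈ S, D * (m : ℝ) ^ 2 := by simp
      _ ≤ ∑ ij ∈ S, ∑ x ∈ classOf p ij.1, ∑ y ∈ classOf p ij.2, |A x y| := by
        refine sum_le_sum fun ij hij => ?_
        obtain ⟨h1, h2, h3⟩ := hS ij hij
        have e1 := hp _ h1
        have e2 := hp _ h2
        have hw := dens_mul_card A (card_pos.mp (e1 ▸ hm)) (card_pos.mp (e2 ▸ hm))
        rw [e1, e2] at hw
        calc D * (m : ℝ) ^ 2
            ≤ |dens A (classOf p ij.1) (classOf p ij.2)| * (m : ℝ) ^ 2 := by gcongr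
          _ = |wSum A (classOf p ij.1) (classOf p ij.2)| := by
            rw [← hw, abs_mul, abs_of_nonneg (by positivity : (0 : ℝ) ≤ m * m), sq]
          _ ≤ _ := (abs_sum_le_sum_abs _ _).trans
            (sum_le_sum fun x _ => abs_sum_le_sum_abs _ _)
      _ ≤ _ := sum_le_sum_of_subset_of_nonneg (subset_univ _) fun _ _ _ =>
        sum_nonneg fun _ _ => sum_nonneg fun _ _ => abs_nonneg _
  have h2 : (Fintype.card V : ℝ) ^ 2 ≤ (2 * (k * m)) ^ 2 := by gcongr
  have h3 : (S.card : ℝ) * D * m ^ 2 ≤ 4 * k ^ 2 * m ^ 2 := by linarith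
  exact le_of_mul_le_mul_right h3 (by positivity)

/-- If `p` is balanced but not regular, then some test function constant on the classes of a
bounded refinement of `p` has noticeably larger energy. -/
lemma exists_energy_increment {V : Type*} [Fintype V] [DecidableEq V] {k : ℕ} {A : V → V → ℝ}
    {ε : ℝ} (hε : 0 < ε) (hA : matNorm A ≤ (Fintype.card V : ℝ) ^ 2) {p : V → Fin (k + 1)}
    (hp : BalancedP p) (hV : 0 < Fintype.card V)
    (hp0 : ((classOf p 0).card : ℝ) < ε * Fintype.card V)
    (hp0' : ((classOf p 0).card : ℝ) ≤ Fintype.card V / 2)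
    (hr : ¬ EpsRegularPartition A ε p p) {s : V → V → ℝ} (hs : ConstOnClasses p s)
    (hsT : ∀ x y, |s x y| ≤ 8 / ε + ε) :
    ∃ (g : V → Fin (k + 1) × (Fin (k + 1) → Bool) × (Fin (k + 1) → Bool)) (t : V → V → ℝ),
      (∀ x y, |t x y| ≤ 8 / ε + ε) ∧
      (∀ x x' y, g x = g x' → p x ≠ 0 → t x y = t x' y) ∧
      (∀ x y y', g y = g y' → p y ≠ 0 → t x y = t x y') ∧
      testEnergy A s + ε ^ 5 / 8 * (Fintype.card V : ℝ) ^ 2 ≤ testEnergy A t := by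
  classical
  set n := Fintype.card V
  obtain ⟨m, hm⟩ : ∃ m, ∀ i, i ≠ 0 → (classOf p i).card = m := by
    by_cases h : ∃ i : Fin (k + 1), i ≠ 0
    · obtain ⟨i, hi⟩ := h
      exact ⟨_, fun j hj => hp j i hj hi⟩
    · push Not at h
      exact ⟨0, fun i hi => absurd (h i) hi⟩
  have hcard : (n : ℝ) = (classOf p 0).card + k * m := by exact_mod_cast card_classes hm
  have hn0 : (0 : ℝ) < n := by exact_mod_cast hV
  have hn2 : (n : ℝ) ≤ 2 * (k * m) := by linarith
  have hm0 : 0 < m := by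
    rcases Nat.eq_zero_or_pos m with h | h
    · simp [h] at hn2; linarith
    · exact h
  set D : ℝ := 8 / ε with hD
  have hD0 : 0 < D := by positivity
  set irr := (univ : Finset (Fin (k + 1) × Fin (k + 1))).filter fun ij =>
      ij.1 ≠ 0 ∧ ij.2 ≠ 0 ∧ ¬ EpsRegular A ε (classOf p ij.1) (classOf p ij.2) with hirr
  have hirrc : ε * k * k < (irr.card : ℝ) := by
    by_contra! h
    exact hr ⟨hp, hp, hp0, hp0, h⟩
  set bad := irr.filter fun ij => |dens A (classOf p ij.1) (classOf p ij.2)| ≤ D with hbad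
  have hdense := card_dense_blocks_le hA hm hm0 hn2 (D := D)
    (irr.filter fun ij => ¬ |dens A (classOf p ij.1) (classOf p ij.2)| ≤ D) (by
      intro ij hij
      simp only [hirr, mem_filter, mem_univ, true_and, not_le] at hij
      exact ⟨hij.1.1, hij.1.2.1, hij.2⟩)
  have hsplit := card_filter_add_card_filter_not (s := irr)
    (fun ij => |dens A (classOf p ij.1) (classOf p ij.2)| ≤ D)
  have hbadc : ε / 2 * k ^ 2 ≤ (bad.card : ℝ) := by
    have h1 : (bad.card : ℝ) + ((irr.filter fun ij =>
      ¬ |dens A (classOf p ij.1) (classOf p ij.2)| ≤ D).card : ℝ) = irr.card := by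
      exact_mod_cast hsplit
    have h2 : ((irr.filter fun ij =>
      ¬ |dens A (classOf p ij.1) (classOf p ij.2)| ≤ D).card : ℝ) ≤ ε / 2 * k ^ 2 := by
      have := mul_le_mul_of_nonneg_right hdense (by positivity : 0 ≤ ε / 8)
      have e : D * (ε / 8) = 1 := by rw [hD]; field_simp
      rw [mul_assoc, e] at this
      linarith
    nlinarith
  have hw : ∀ ij : Fin (k + 1) × Fin (k + 1), ∃ (X' Y' : Finset V) (τ : ℝ), |τ| ≤ ε ∧
      (ij ∈ bad → ∀ σ : ℝ,
      ∑ x ∈ classOf p ij.1, ∑ y ∈ classOf p ij.2, (2 * σ * A x y - σ ^ 2) + ε ^ 4 * (m * m) ≤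
        ∑ x ∈ classOf p ij.1, ∑ y ∈ classOf p ij.2,
          (2 * (dens A (classOf p ij.1) (classOf p ij.2)
              + if x ∈ X' ∧ y ∈ Y' then τ else 0) * A x y
          - (dens A (classOf p ij.1) (classOf p ij.2)
              + if x ∈ X' ∧ y ∈ Y' then τ else 0) ^ 2)) := by
    intro ij
    by_cases h : ij ∈ bad
    · have h' := h
      simp only [hbad, hirr, mem_filter, mem_univ, true_and] at h'
      obtain ⟨⟨h1, h2, h3⟩, -⟩ := h'
      have e1 := hm _ h1
      have e2 := hm _ h2
      obtain ⟨X', Y', τ, hτ, hgain⟩ := exists_perturbation hε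
        (card_pos.mp (e1 ▸ hm0)) (card_pos.mp (e2 ▸ hm0)) h3
      rw [e1, e2] at hgain
      exact ⟨X', Y', τ, hτ, fun _ => hgain⟩
    · exact ⟨∅, ∅, 0, by simpa using hε.le, fun h' => absurd h' h⟩
  choose X' Y' τ hτ hgain using hw
  set t : V → V → ℝ := fun x y => if (p x, p y) ∈ bad then
    dens A (classOf p (p x)) (classOf p (p y))
      + (if x ∈ X' (p x, p y) ∧ y ∈ Y' (p x, p y) then τ (p x, p y) else 0) else s x y with ht
  refine ⟨fun x => (p x, fun j => decide (x ∈ X' (p x, j)), fun j => decide (x ∈ Y' (j, p x))),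
    t, ?_, ?_, ?_, ?_⟩
  · intro x y
    simp only [ht]
    split_ifs with h1 h2
    · exact (abs_add_le _ _).trans (add_le_add (mem_filter.mp h1).2 (hτ _))
    · rw [add_zero]
      exact (mem_filter.mp h1).2.trans (by linarith)
    · exact hsT x y
  · intro x x' y hg hx
    simp only [Prod.mk.injEq] at hg
    obtain ⟨h1, h2, -⟩ := hg
    have h3 : x ∈ X' (p x, p y) ↔ x' ∈ X' (p x', p y) := by
      simpa using congrFun h2 (p y)
    rw [← h1] at h3
    simp only [ht, ← h1, h3, hs.1 x x' y h1 hx]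
  · intro x y y' hg hy
    simp only [Prod.mk.injEq] at hg
    obtain ⟨h1, -, h2⟩ := hg
    have h3 : y ∈ Y' (p x, p y) ↔ y' ∈ Y' (p x, p y') := by
      simpa using congrFun h2 (p x)
    rw [← h1] at h3
    simp only [ht, ← h1, h3, hs.2 x y y' h1 hy]
  · have hblock : ∀ ij : Fin (k + 1) × Fin (k + 1),
        ∑ x ∈ classOf p ij.1, ∑ y ∈ classOf p ij.2, (2 * s x y * A x y - s x y ^ 2)
          + (if ij ∈ bad then ε ^ 4 * ((m : ℝ) * m) else 0)
        ≤ ∑ x ∈ classOf p ij.1, ∑ y ∈ classOf p ij.2, (2 * t x y * A x y - t x y ^ 2) := by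
      rintro ⟨i, j⟩
      by_cases h : (i, j) ∈ bad
      · have h' := h
        simp only [hbad, hirr, mem_filter, mem_univ, true_and] at h'
        obtain ⟨⟨hi, hj, -⟩, -⟩ := h'
        obtain ⟨x₀, hx₀⟩ := card_pos.mp ((hm i hi).symm ▸ hm0)
        obtain ⟨y₀, hy₀⟩ := card_pos.mp ((hm j hj).symm ▸ hm0)
        have hmem : ∀ {l x}, x ∈ classOf p l ↔ p x = l := by simp [classOf]
        rw [hmem] at hx₀ hy₀
        have hg := hgain (i, j) h (s x₀ y₀)
        rw [if_pos h]
        refine le_trans (le_of_eq ?_) (hg.trans (le_of_eq ?_))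
        · congr 1
          refine sum_congr rfl fun x hx => sum_congr rfl fun y hy => ?_
          rw [hmem] at hx hy
          rw [hs.1 x x₀ y (by rw [hx, hx₀]) (by rwa [hx]),
            hs.2 x₀ y y₀ (by rw [hy, hy₀]) (by rwa [hy])]
        · refine sum_congr rfl fun x hx => sum_congr rfl fun y hy => ?_
          rw [hmem] at hx hy
          simp only [ht, hx, hy, h, if_true]
      · rw [if_neg h, add_zero]
        refine le_of_eq (sum_congr rfl fun x hx => sum_congr rfl fun y hy => ?_)
        simp only [classOf, mem_filter, mem_univ, true_and] at hx hy
        simp only [ht, hx, hy, h, if_false]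
    have htot := sum_le_sum fun ij (_ : ij ∈ univ) => hblock ij
    rw [sum_add_distrib, ← sum_eq_sum_classOf p (fun x y => 2 * s x y * A x y - s x y ^ 2),
      ← sum_eq_sum_classOf p (fun x y => 2 * t x y * A x y - t x y ^ 2), sum_ite_mem,
      univ_inter, sum_const, nsmul_eq_mul] at htot
    refine le_trans ?_ htot
    have h1 : (n : ℝ) ^ 2 ≤ (2 * (k * m)) ^ 2 := by gcongr
    refine add_le_add le_rfl ?_
    calc ε ^ 5 / 8 * (n : ℝ) ^ 2 ≤ ε ^ 5 / 8 * (2 * (k * m)) ^ 2 := by gcongr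
      _ = ε / 2 * k ^ 2 * (ε ^ 4 * (m * m)) := by ring
      _ ≤ _ := by gcongr

/-- Iterating the energy increment: after `i` rounds one has found a regular partition or a
partition admitting a test function of energy at least `i * ε ^ 5 / 8 * n ^ 2`. -/
lemma exists_regular_or_energy {ε : ℝ} (hε : 0 < ε) (hε1 : ε ≤ 1) {L : ℕ} (hL : 0 < L) {β : ℝ}
    (hβ : 0 < β) (i : ℕ) (hi : (i + 1) * β ≤ ε / 2) :
    ∃ M : ℕ, L ≤ M ∧ ∀ n : ℕ, M ≤ n → ∀ A : Fin n → Fin n → ℝ, matNorm A ≤ (n : ℝ) ^ 2 →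
      (∃ (k : ℕ) (p : Fin n → Fin (k + 1)), L ≤ k ∧ k ≤ M ∧ EpsRegularPartition A ε p p) ∨
      ∃ (k : ℕ) (p : Fin n → Fin (k + 1)) (s : Fin n → Fin n → ℝ),
        L ≤ k ∧ k ≤ M ∧ BalancedP p ∧ ((classOf p 0).card : ℝ) ≤ (i + 1) * β * n ∧
        (∀ x y, |s x y| ≤ 8 / ε + ε) ∧ ConstOnClasses p s ∧
        i * (ε ^ 5 / 8 * (n : ℝ) ^ 2) ≤ testEnergy A s := by
  induction i with
  | zero =>
    obtain ⟨R₀, hR₀⟩ := exists_nat_ge (1 / β)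
    set R := R₀ + 2 * L with hR
    refine ⟨2 * R, by omega, fun n hn A _ => Or.inr ?_⟩
    have hβR : 1 ≤ β * R := by
      rw [div_le_iff₀ hβ] at hR₀
      have : (R₀ : ℝ) ≤ R := by exact_mod_cast (by omega : R₀ ≤ R)
      nlinarith
    have hn0 : (0 : ℝ) ≤ n := Nat.cast_nonneg n
    obtain ⟨k, q, h1, h2, h3, h4, -, -⟩ := exists_refinement (V := Fin n) (fun _ => ())
      hL (by omega : 2 * L ≤ R) (by simp; omega) (β := β) (b := 0) (by simpa using hβR) univ
      (by simp) (by simp only [Fintype.card_fin]; push_cast at hi; nlinarith)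
    refine ⟨k, q, fun _ _ => 0, h1, h2, h3, ?_, ?_, ?_, ?_⟩
    · simpa using h4
    · intro x y
      rw [abs_zero]
      positivity
    · exact ⟨fun _ _ _ _ _ => rfl, fun _ _ _ _ _ => rfl⟩
    · simp [testEnergy]
  | succ i ih =>
    push_cast at hi
    obtain ⟨M, hLM, hM⟩ := ih (by nlinarith)
    set N : ℕ := (M + 1) * (2 ^ (M + 1) * 2 ^ (M + 1)) with hN
    obtain ⟨R₀, hR₀⟩ := exists_nat_ge (N / β)
    set R := R₀ + 2 * L with hR
    refine ⟨M + 2 * R, by omega, fun n hn A hA => ?_⟩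
    rcases hM n (by omega) A hA with ⟨k, p, h1, h2, h3⟩ |
      ⟨k, p, s, hLk, hkM, hp, hp0, hsT, hs, hsE⟩
    · exact Or.inl ⟨k, p, h1, by omega, h3⟩
    by_cases hr : EpsRegularPartition A ε p p
    · exact Or.inl ⟨k, p, hLk, by omega, hr⟩
    refine Or.inr ?_
    have hnpos : 0 < n := by omega
    have hn0 : (0 : ℝ) < n := by exact_mod_cast hnpos
    have hbn : ((i : ℝ) + 1) * β * n ≤ ε / 2 * n - β * n := by
      have : ((i : ℝ) + 1) * β ≤ ε / 2 - β := by linarith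
      calc ((i : ℝ) + 1) * β * n ≤ (ε / 2 - β) * n := by gcongr
        _ = _ := by ring
    have hεn : ε * n ≤ n := by nlinarith
    have hβn : 0 < β * n := by positivity
    have hεn0 : 0 < ε * n := by positivity
    obtain ⟨g, t, htT, ht1, ht2, htE⟩ := exists_energy_increment (V := Fin n) hε
      (by simpa using hA) hp (by simpa using hnpos) (by rw [Fintype.card_fin]; linarith)
      (by rw [Fintype.card_fin]; linarith) hr hs hsT
    rw [Fintype.card_fin] at htE
    have hβR : (N : ℝ) ≤ β * R := by
      rw [div_le_iff₀ hβ] at hR₀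
      have : (R₀ : ℝ) ≤ R := by exact_mod_cast (by omega : R₀ ≤ R)
      nlinarith
    have hcard : Fintype.card (Fin (k + 1) × (Fin (k + 1) → Bool) × (Fin (k + 1) → Bool)) ≤ N := by
      simp only [Fintype.card_prod, Fintype.card_fun, Fintype.card_fin, Fintype.card_bool, hN]
      gcongr <;> norm_num
    obtain ⟨k', q, h1, h2, h3, h4, h5, h6⟩ := exists_refinement g hL (by omega : 2 * L ≤ R)
      (by rw [Fintype.card_fin]; omega) (β := β) (b := (i + 1) * β * n)
      ((Nat.cast_le.mpr hcard).trans hβR) (univ.filter fun x => p x ≠ 0)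
      (by simpa [classOf] using hp0) (by rw [Fintype.card_fin]; linarith)
    have hqp : ∀ x, q x ≠ 0 → p x ≠ 0 := fun x hx h0 => hx (h5 x (by simp [h0]))
    refine ⟨k', q, t, h1, by omega, h3, ?_, htT, ?_, ?_⟩
    · rw [Fintype.card_fin] at h4
      push_cast
      linarith
    · exact ⟨fun x x' y h hx => ht1 x x' y (h6 x x' h hx) (hqp x hx),
        fun x y y' h hy => ht2 x y y' (h6 y y' h hy) (hqp y hy)⟩
    · push_cast
      linarith

/-- **Szemerédi's Regularity Lemma for square matrices.**  For every `ε > 0` and every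
positive integer `L` there is a positive integer `M ≥ L` such that for all `n ≥ M`, every
nonzero real `n × n` matrix `A` (not necessarily symmetric) has a symmetric `(ε)`-regular
block partition `(𝒫,𝒫)` with exceptional set and `L ≤ |𝒫| ≤ M`. -/
theorem sparse_regularity_for_square_matrices (ε : ℝ) (hε : 0 < ε) (L : ℕ) (hL : 0 < L) :
    ∃ M : ℕ, 0 < M ∧ L ≤ M ∧
      ∀ n : ℕ, M ≤ n → ∀ A : Fin n → Fin n → ℝ, A ≠ 0 →
        ∃ (k : ℕ) (p : Fin n → Fin (k + 1)),
          L ≤ k ∧ k ≤ M ∧ ScaledEpsRegularPartition A ε p p := by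
  set δ := min ε 1
  have hδ : 0 < δ := lt_min hε one_pos
  obtain ⟨N, hN⟩ := exists_nat_gt (2 * (8 / δ + δ) / (δ ^ 5 / 8))
  rw [div_lt_iff₀ (by positivity)] at hN
  have hN1 : (0 : ℝ) < (N : ℝ) + 1 := by positivity
  obtain ⟨M, hLM, hM⟩ := exists_regular_or_energy hδ (min_le_right ε 1) hL
    (β := δ / 2 / (N + 1)) (by positivity) N (by rw [mul_div_cancel₀ _ hN1.ne'])
  refine ⟨M, by omega, hLM, fun n hn A hA => ?_⟩
  have hnorm : matNorm (normalizeMat A) = (n : ℝ) ^ 2 := by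
    rw [matNorm_normalizeMat hA, Fintype.card_fin, sq]
  rcases hM n hn _ hnorm.le with ⟨k, p, h1, h2, h3⟩ | ⟨k, p, s, -, -, -, -, hsT, -, hsE⟩
  · exact ⟨k, p, h1, h2, h3.mono (min_le_left ε 1)⟩
  · have hle := hsE.trans (testEnergy_le hsT)
    rw [hnorm, ← mul_assoc] at hle
    have hn0 : (0 : ℝ) < n := by exact_mod_cast (by omega : 0 < n)
    exact absurd (le_of_mul_le_mul_right hle (by positivity)) hN.not_ge
end

section
/- For every ε ∈ (0,1) and all positive integers L and k there is a positive integer M (with M ≥ L) such that for all m, n ≥ M and every sequence A⁽¹⁾,…,A⁽ᵏ⁾ of m × n matrices with nonnegative entries, each having at least one positive entry, there is a block partition (𝒫,𝒬) with exceptional sets, with L ≤ |𝒫| ≤ M and L ≤ |𝒬| ≤ M, that is simultaneously (ε)-regular for each A⁽ⁱ⁾. -/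
open Finset

section CellAverages

variable {Ω γ γ' : Type*} [Fintype Ω]

open Classical in
/-- The cell of `ω` in the partition of `Ω` into fibres of `π`. -/
noncomputable def cell (π : Ω → γ) (ω : Ω) : Finset Ω :=
  Finset.univ.filter fun x => π x = π ω

/-- The conditional expectation of `f` on the fibres of `π`. -/
noncomputable def avg (π : Ω → γ) (f : Ω → ℝ) (ω : Ω) : ℝ :=
  (∑ x ∈ cell π ω, f x) / ((cell π ω).card : ℝ)

/-- The energy of `f` relative to `π`, built from the bounded convex function `1 / (1 + t)`. -/
noncomputable def energy (π : Ω → γ) (f : Ω → ℝ) : ℝ :=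
  ∑ ω, 1 / (1 + avg π f ω)

lemma mem_cell {π : Ω → γ} {ω x : Ω} : x ∈ cell π ω ↔ π x = π ω := by
  simp [cell]

lemma cell_congr {π : Ω → γ} {x y : Ω} (h : π x = π y) : cell π x = cell π y := by
  ext z; simp [mem_cell, h]

lemma avg_congr {π : Ω → γ} (f : Ω → ℝ) {x y : Ω} (h : π x = π y) : avg π f x = avg π f y := by
  simp [avg, cell_congr h]

lemma avg_nonneg {π : Ω → γ} {f : Ω → ℝ} (hf : ∀ x, 0 ≤ f x) (ω : Ω) : 0 ≤ avg π f ω :=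
  div_nonneg (Finset.sum_nonneg fun x _ => hf x) (Nat.cast_nonneg _)

lemma sum_mul_avg (π : Ω → γ) (f c : Ω → ℝ) (hc : ∀ x y, π x = π y → c x = c y) :
    ∑ ω, c ω * avg π f ω = ∑ ω, c ω * f ω := by
  classical
  calc ∑ ω, c ω * avg π f ω
      = ∑ ω, ∑ x, if π x = π ω then c x * f x / ((cell π x).card : ℝ) else 0 := by
        refine Finset.sum_congr rfl fun ω _ => ?_
        rw [avg, Finset.sum_div, Finset.mul_sum, ← Finset.sum_filter]
        refine Finset.sum_congr (by ext; simp [mem_cell]) fun x hx => ?_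
        have h : π x = π ω := by simpa using hx
        rw [cell_congr h, hc x ω h, mul_div_assoc]
    _ = ∑ x, ∑ ω, if π x = π ω then c x * f x / ((cell π x).card : ℝ) else 0 :=
        Finset.sum_comm
    _ = ∑ x, c x * f x := by
        refine Finset.sum_congr rfl fun x _ => ?_
        rw [← Finset.sum_filter, Finset.sum_const, nsmul_eq_mul]
        have h1 : (Finset.univ.filter fun ω => π x = π ω) = cell π x := by
          ext; simp [mem_cell, eq_comm]
        have h2 : ((cell π x).card : ℝ) ≠ 0 :=
          Nat.cast_ne_zero.2 (Finset.card_ne_zero_of_mem (mem_cell.2 rfl))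
        rw [h1]; field_simp

lemma sum_avg_of_saturated {π : Ω → γ} (f : Ω → ℝ) {S : Finset Ω}
    (hS : ∀ x y, π x = π y → x ∈ S → y ∈ S) : ∑ ω ∈ S, avg π f ω = ∑ ω ∈ S, f ω := by
  classical
  have h := sum_mul_avg π f (fun ω => if ω ∈ S then 1 else 0) fun x y hxy => by
    have : x ∈ S ↔ y ∈ S := ⟨hS x y hxy, hS y x hxy.symm⟩
    simp [this]
  simpa using h

lemma energy_sub_energy {π : Ω → γ} {π' : Ω → γ'} {f : Ω → ℝ} (hf : ∀ x, 0 ≤ f x)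
    (href : ∀ x y, π' x = π' y → π x = π y) :
    energy π' f - energy π f =
      ∑ ω, (avg π' f ω - avg π f ω) ^ 2 / ((1 + avg π' f ω) * (1 + avg π f ω) ^ 2) := by
  have hc : ∀ x y, π x = π y → 1 / (1 + avg π f x) ^ 2 = 1 / (1 + avg π f y) ^ 2 := by
    intro x y h
    rw [avg_congr f h]
  have h1 := sum_mul_avg π f (fun ω => 1 / (1 + avg π f ω) ^ 2) hc
  have h2 := sum_mul_avg π' f (fun ω => 1 / (1 + avg π f ω) ^ 2) fun x y h => hc x y (href x y h)
  have h3 : ∑ ω, (1 / (1 + avg π f ω) ^ 2 * avg π' f ω - 1 / (1 + avg π f ω) ^ 2 * avg π f ω)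
      = 0 := by
    rw [Finset.sum_sub_distrib, h1, h2, sub_self]
  rw [energy, energy, ← Finset.sum_sub_distrib, ← add_zero (∑ ω, (_ - _)), ← h3,
    ← Finset.sum_add_distrib]
  refine Finset.sum_congr rfl fun ω _ => ?_
  have ha := avg_nonneg (π := π) hf ω
  have hg := avg_nonneg (π := π') hf ω
  have ha' : 1 + avg π f ω ≠ 0 := by positivity
  have hg' : 1 + avg π' f ω ≠ 0 := by positivity
  field_simp
  ring

lemma energy_mono {π : Ω → γ} {π' : Ω → γ'} {f : Ω → ℝ} (hf : ∀ x, 0 ≤ f x)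
    (href : ∀ x y, π' x = π' y → π x = π y) : energy π f ≤ energy π' f := by
  rw [← sub_nonneg, energy_sub_energy hf href]
  refine Finset.sum_nonneg fun ω _ => ?_
  have := avg_nonneg (π := π) hf ω
  have := avg_nonneg (π := π') hf ω
  positivity

lemma energy_nonneg (π : Ω → γ) {f : Ω → ℝ} (hf : ∀ x, 0 ≤ f x) : 0 ≤ energy π f :=
  Finset.sum_nonneg fun ω _ => by
    have := avg_nonneg (π := π) hf ω
    positivity

lemma energy_le_card (π : Ω → γ) {f : Ω → ℝ} (hf : ∀ x, 0 ≤ f x) :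
    energy π f ≤ Fintype.card Ω := by
  calc energy π f ≤ ∑ _ω : Ω, (1 : ℝ) := Finset.sum_le_sum fun ω _ => by
        have := avg_nonneg (π := π) hf ω
        rw [div_le_one (by positivity)]
        linarith
    _ = Fintype.card Ω := by simp

lemma sq_div_lower_bound {ε D d d' : ℝ} (hε0 : 0 < ε) (hε1 : ε < 1) (hd : 0 ≤ d) (hdD : d ≤ D)
    (hd' : 0 ≤ d') (h : ε < |d' - d|) :
    ε ^ 2 / (2 + D) ^ 3 ≤ (d' - d) ^ 2 / ((1 + d') * (1 + d) ^ 2) := by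
  have hD : 0 ≤ D := hd.trans hdD
  have hsq : ε ^ 2 ≤ (d' - d) ^ 2 := by
    rw [← sq_abs (d' - d)]
    gcongr
  have hkey : ε ^ 2 * (1 + d') ≤ (d' - d) ^ 2 * (2 + D) := by
    rcases le_total d' (1 + D) with h1 | h1
    · calc ε ^ 2 * (1 + d') ≤ (d' - d) ^ 2 * (1 + d') := by gcongr
        _ ≤ _ := mul_le_mul_of_nonneg_left (by linarith) (sq_nonneg _)
    · have hu : 1 ≤ d' - d := by linarith
      have : ε ^ 2 ≤ 1 := by nlinarith
      calc ε ^ 2 * (1 + d') ≤ 1 * (1 + d') := by gcongr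
        _ ≤ (d' - d) * (2 + D) := by nlinarith
        _ ≤ _ := by
          gcongr
          nlinarith
  rw [div_le_div_iff₀ (by positivity) (by positivity)]
  calc ε ^ 2 * ((1 + d') * (1 + d) ^ 2) = ε ^ 2 * (1 + d') * (1 + d) ^ 2 := by ring
    _ ≤ (d' - d) ^ 2 * (2 + D) * (2 + D) ^ 2 := by
      gcongr
      linarith
    _ = _ := by ring

lemma sum_sq_div_lower_bound {ε D d : ℝ} (hε0 : 0 < ε) (hε1 : ε < 1) {π' : Ω → γ'} {f : Ω → ℝ}
    (hf : ∀ x, 0 ≤ f x) {S : Finset Ω} (hS : ∀ x y, π' x = π' y → x ∈ S → y ∈ S)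
    (hne : S.Nonempty) (hd : 0 ≤ d) (hdD : d ≤ D) (h : ε < |(∑ ω ∈ S, f ω) / S.card - d|) :
    S.card * (ε ^ 2 / (2 + D) ^ 3) ≤
      ∑ ω ∈ S, (avg π' f ω - d) ^ 2 / ((1 + avg π' f ω) * (1 + d) ^ 2) := by
  have hcard : (0 : ℝ) < S.card := Nat.cast_pos.2 hne.card_pos
  set d' := (∑ ω ∈ S, f ω) / S.card with hd'def
  have hd' : 0 ≤ d' := div_nonneg (Finset.sum_nonneg fun x _ => hf x) hcard.le
  have hsum : ∑ ω ∈ S, avg π' f ω = S.card * d' := by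
    rw [sum_avg_of_saturated f hS, hd'def]
    field_simp
  calc S.card * (ε ^ 2 / (2 + D) ^ 3) ≤ S.card * ((d' - d) ^ 2 / ((1 + d') * (1 + d) ^ 2)) := by
        exact mul_le_mul_of_nonneg_left (sq_div_lower_bound hε0 hε1 hd hdD hd' h) hcard.le
    _ = (∑ ω ∈ S, (avg π' f ω - d)) ^ 2 / ∑ ω ∈ S, (1 + avg π' f ω) * (1 + d) ^ 2 := by
        rw [← Finset.sum_mul, Finset.sum_sub_distrib, Finset.sum_add_distrib, hsum]
        simp only [Finset.sum_const, nsmul_eq_mul, mul_one]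
        rw [← mul_sub, show (S.card : ℝ) + S.card * d' = S.card * (1 + d') by ring]
        field_simp
    _ ≤ _ := by
        refine Finset.sq_sum_div_le_sum_sq_div S _ fun ω _ => ?_
        have := avg_nonneg (π := π') hf ω
        positivity

end CellAverages

section Chopping

variable {V α : Type*} [Fintype V]

lemma mem_classOf {k : ℕ} {p : V → Fin (k + 1)} {i : Fin (k + 1)} {x : V} :
    x ∈ classOf p i ↔ p x = i := by
  simp [classOf]

lemma exists_equal_chop [Fintype α] (a : V → α) {c : ℕ} (hc : 0 < c) (E : Finset V) :
    ∃ (r : ℕ) (p : V → Fin (r + 1)), (∀ i, i ≠ 0 → (classOf p i).card = c) ∧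
      (∀ x ∈ E, p x = 0) ∧ (classOf p 0).card ≤ E.card + Fintype.card α * c ∧
      ∀ x y, p x = p y → p x ≠ 0 → a x = a y := by
  classical
  induction h : Fintype.card V - E.card using Nat.strong_induction_on generalizing E with
  | _ N ih =>
  by_cases hv : ∃ v, c ≤ (Eᶜ.filter fun x => a x = v).card
  · obtain ⟨v, hv⟩ := hv
    obtain ⟨T, hT, hTc⟩ := Finset.exists_subset_card_eq hv
    have hTE : Disjoint E T := by
      rw [Finset.disjoint_left]
      intro x hx hxT
      have := hT hxT
      simp_all
    have hTa : ∀ x ∈ T, a x = v := fun x hx => (Finset.mem_filter.1 (hT hx)).2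
    have hcard : (E ∪ T).card = E.card + c := by rw [Finset.card_union_of_disjoint hTE, hTc]
    have hle : (E ∪ T).card ≤ Fintype.card V := Finset.card_le_univ _
    obtain ⟨r, p, h1, h2, h3, h4⟩ := ih _ (by omega) (E ∪ T) rfl
    have hpT : ∀ x ∈ T, p x = 0 := fun x hx => h2 x (Finset.mem_union_right _ hx)
    refine ⟨r + 1, fun x => if x ∈ T then Fin.last (r + 1) else (p x).castSucc, ?_, ?_, ?_, ?_⟩
    · intro i
      refine Fin.lastCases (fun _ => ?_) (fun i hi => ?_) i
      · rw [← hTc]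
        congr 1
        ext x
        rw [mem_classOf]
        by_cases hx : x ∈ T <;> simp [hx, Fin.castSucc_ne_last]
      · have hi0 : i ≠ 0 := by rintro rfl; exact hi rfl
        rw [← h1 i hi0]
        congr 1
        ext x
        rw [mem_classOf, mem_classOf]
        by_cases hx : x ∈ T
        · simp [hx, hpT x hx, hi0.symm, (Fin.castSucc_ne_last i).symm]
        · simp [hx]
    · intro x hx
      have : x ∉ T := Finset.disjoint_left.1 hTE hx
      simp [this, h2 x (Finset.mem_union_left _ hx)]
    · have hsub : classOf (fun x => if x ∈ T then Fin.last (r + 1) else (p x).castSucc) 0 =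
          classOf p 0 \ T := by
        ext x
        rw [mem_classOf, Finset.mem_sdiff, mem_classOf]
        by_cases hx : x ∈ T
        · simp [hx, (Fin.last_pos (n := r)).ne']
        · simp [hx]
      have hTs : T ⊆ classOf p 0 := fun x hx => mem_classOf.2 (hpT x hx)
      rw [hsub, Finset.card_sdiff_of_subset hTs, hTc]
      omega
    · intro x y hxy hx0
      by_cases hx : x ∈ T <;> by_cases hy : y ∈ T
      · rw [hTa x hx, hTa y hy]
      · simp [hx, hy, (Fin.castSucc_ne_last _).symm] at hxy
      · simp [hx, hy, Fin.castSucc_ne_last] at hxy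
      · simp only [hx, hy, if_false] at hxy hx0
        exact h4 x y (Fin.castSucc_injective _ hxy) fun h => hx0 (by simp [h])
  · push Not at hv
    refine ⟨0, fun _ => 0, fun i hi => absurd (Fin.fin_one_eq_zero i) hi, fun _ _ => rfl, ?_,
      fun x y _ h => absurd rfl h⟩
    have h1 : Eᶜ.card ≤ c * (Finset.univ : Finset α).card :=
      Finset.card_le_mul_card_image_of_maps_to (f := a) (fun _ _ => Finset.mem_univ _) c
        fun v _ => (hv v).le
    have h2 := Finset.card_add_card_compl E
    have h3 : (classOf (fun _ : V => (0 : Fin (0 + 1))) 0).card ≤ Fintype.card V :=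
      Finset.card_le_univ _
    rw [Finset.card_univ, mul_comm] at h1
    omega

lemma card_classOf_add {r c : ℕ} {p : V → Fin (r + 1)}
    (h : ∀ i, i ≠ 0 → (classOf p i).card = c) :
    (classOf p 0).card + r * c = Fintype.card V := by
  have h1 : Fintype.card V = ∑ i : Fin (r + 1), (classOf p i).card :=
    Finset.card_eq_sum_card_fiberwise (f := p) (s := Finset.univ) (t := Finset.univ)
      fun _ _ => Finset.mem_coe.2 (Finset.mem_univ _)
  rw [h1, Fin.sum_univ_succ, Finset.sum_congr rfl fun i _ => h i.succ (Fin.succ_ne_zero i)]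
  simp

lemma exists_balanced_chop [Fintype α] (a : V → α) (E : Finset V) {K : ℕ} {δ : ℝ} (hK : 0 < K)
    (hα : Fintype.card α ≤ K) (hδ0 : 0 < δ) (hδ1 : δ ≤ 1 / 2)
    (hV : (K : ℝ) / δ ≤ Fintype.card V)
    (hE : (E.card : ℝ) + δ * Fintype.card V ≤ Fintype.card V / 2) :
    ∃ (r : ℕ) (p : V → Fin (r + 1)), K ≤ r ∧ (r : ℝ) ≤ 2 * K / δ ∧ BalancedP p ∧
      (∀ x ∈ E, p x = 0) ∧ ((classOf p 0).card : ℝ) ≤ E.card + δ * Fintype.card V ∧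
      ∀ x y, p x = p y → p x ≠ 0 → a x = a y := by
  obtain ⟨N, hN⟩ : ∃ N : ℝ, N = Fintype.card V := ⟨_, rfl⟩
  rw [← hN] at hV hE ⊢
  have hK' : (0 : ℝ) < K := by exact_mod_cast hK
  have hNK : (K : ℝ) ≤ δ * N := by rwa [div_le_iff₀' hδ0] at hV
  have hNpos : 0 < N := lt_of_lt_of_le (by positivity) hV
  set c := ⌊δ * N / K⌋₊ with hcdef
  have hc1 : (c : ℝ) * K ≤ δ * N := by
    rw [← le_div_iff₀ hK']
    exact Nat.floor_le (by positivity)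
  have hone : 1 ≤ c := Nat.le_floor (by rw [Nat.cast_one, le_div_iff₀ hK']; linarith)
  have hone' : (1 : ℝ) ≤ c := by exact_mod_cast hone
  have hc2 : δ * N < (c + 1) * K := by
    rw [← div_lt_iff₀ hK']
    exact Nat.lt_floor_add_one _
  obtain ⟨r, p, h1, h2, h3, h4⟩ := exists_equal_chop a hone E
  have hsum : ((classOf p 0).card : ℝ) + r * c = N := by
    rw [hN]
    exact_mod_cast card_classOf_add h1
  have h3' : ((classOf p 0).card : ℝ) ≤ E.card + δ * N := by
    have : ((classOf p 0).card : ℝ) ≤ E.card + Fintype.card α * c := by exact_mod_cast h3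
    have : (Fintype.card α : ℝ) * c ≤ K * c := by gcongr
    linarith
  refine ⟨r, p, ?_, ?_, fun i j hi hj => (h1 i hi).trans (h1 j hj).symm, h2, h3', h4⟩
  · have h5 : N / 2 ≤ r * c := by linarith
    have h6 : (c : ℝ) * K ≤ r * c := by nlinarith
    have : (K : ℝ) ≤ r := by nlinarith
    exact_mod_cast this
  · rw [le_div_iff₀ hδ0]
    have h5 : (r : ℝ) * c ≤ N := by
      have : (0 : ℝ) ≤ (classOf p 0).card := Nat.cast_nonneg _
      linarith
    have h6 : δ * (r * c) ≤ 2 * c * K := by nlinarith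
    have : (r * δ) * c ≤ (2 * K) * c := by linarith
    exact le_of_mul_le_mul_right this (by linarith)

end Chopping

section Blocks

variable {V W : Type*}

/-- Labels the classes of the partition obtained by splitting the exceptional class of `p` into
singletons. -/
def splitLabel {r : ℕ} (p : V → Fin (r + 1)) (x : V) : Fin (r + 1) ⊕ V :=
  if p x = 0 then Sum.inr x else Sum.inl (p x)

/-- Labels the blocks of `(p, q)` after splitting both exceptional classes into singletons. -/
def blockLabel {r s : ℕ} (p : V → Fin (r + 1)) (q : W → Fin (s + 1)) (ω : V × W) :
    (Fin (r + 1) ⊕ V) × (Fin (s + 1) ⊕ W) :=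
  (splitLabel p ω.1, splitLabel q ω.2)

lemma splitLabel_eq_iff {r : ℕ} {p : V → Fin (r + 1)} {x y : V} :
    splitLabel p x = splitLabel p y ↔ x = y ∨ p x = p y ∧ p x ≠ 0 := by
  unfold splitLabel
  by_cases hx : p x = 0 <;> by_cases hy : p y = 0 <;> simp [hx, hy]
  · rintro rfl
    exact hy hx
  · rintro rfl
    exact hx hy
  · rintro rfl
    rfl

variable [Fintype V] [Fintype W]

lemma avg_blockLabel {r s : ℕ} {p : V → Fin (r + 1)} {q : W → Fin (s + 1)} (f : V → W → ℝ)
    {ω : V × W} (hx : p ω.1 ≠ 0) (hy : q ω.2 ≠ 0) :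
    avg (blockLabel p q) (fun ω => f ω.1 ω.2) ω =
      dens f (classOf p (p ω.1)) (classOf q (q ω.2)) := by
  have h : cell (blockLabel p q) ω = classOf p (p ω.1) ×ˢ classOf q (q ω.2) := by
    ext z
    rw [mem_cell, Finset.mem_product, mem_classOf, mem_classOf, blockLabel, blockLabel,
      Prod.mk.injEq, splitLabel_eq_iff, splitLabel_eq_iff]
    constructor
    · rintro ⟨h1 | h1, h2 | h2⟩ <;> simp [h1, h2]
    · rintro ⟨h1, h2⟩
      exact ⟨Or.inr ⟨h1, h1 ▸ hx⟩, Or.inr ⟨h2, h2 ▸ hy⟩⟩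
  rw [avg, h, Finset.sum_product, Finset.card_product, _root_.dens, wSum, Nat.cast_mul]

lemma sum_blocks_le {r s : ℕ} {p : V → Fin (r + 1)} {q : W → Fin (s + 1)} {g : V × W → ℝ}
    (hg : ∀ ω, 0 ≤ g ω) (B : Finset (Fin (r + 1) × Fin (s + 1)))
    (S : Fin (r + 1) × Fin (s + 1) → Finset (V × W))
    (hS : ∀ ij ∈ B, S ij ⊆ classOf p ij.1 ×ˢ classOf q ij.2) :
    ∑ ij ∈ B, ∑ ω ∈ S ij, g ω ≤ ∑ ω, g ω := by
  classical
  rw [← Finset.sum_biUnion]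
  · exact Finset.sum_le_sum_of_subset_of_nonneg (Finset.subset_univ _) fun ω _ _ => hg ω
  · intro ij hij kl hkl hne
    refine Finset.disjoint_left.2 fun ω h1 h2 => hne ?_
    have h1 := Finset.mem_product.1 (hS ij hij h1)
    have h2 := Finset.mem_product.1 (hS kl hkl h2)
    rw [mem_classOf, mem_classOf] at h1 h2
    exact Prod.ext (h1.1.symm.trans h2.1) (h1.2.symm.trans h2.2)

/-- A lower bound, as a proportion of the number of entries, for the energy gained by refining a
partition with many irregular blocks. -/
noncomputable def energyGain (ε : ℝ) : ℝ :=
  ε ^ 5 / (8 * (2 + 8 / ε) ^ 3)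

lemma energyGain_pos {ε : ℝ} (hε : 0 < ε) : 0 < energyGain ε := by
  unfold energyGain
  positivity

lemma energy_add_gain_le {ε : ℝ} (hε0 : 0 < ε) (hε1 : ε < 1) {f : V → W → ℝ}
    (hf : ∀ x y, 0 ≤ f x y)
    (hsum : ∑ x, ∑ y, f x y = (Fintype.card V : ℝ) * Fintype.card W)
    {r s r' s' : ℕ} {p : V → Fin (r + 1)} {q : W → Fin (s + 1)}
    {p' : V → Fin (r' + 1)} {q' : W → Fin (s' + 1)} {c e : ℕ} (hc0 : 0 < c) (he0 : 0 < e)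
    (hc : ∀ i, i ≠ 0 → (classOf p i).card = c) (he : ∀ j, j ≠ 0 → (classOf q j).card = e)
    (hV : (Fintype.card V : ℝ) ≤ 2 * (r * c)) (hW : (Fintype.card W : ℝ) ≤ 2 * (s * e))
    (hp : ∀ x y, splitLabel p' x = splitLabel p' y → splitLabel p x = splitLabel p y)
    (hq : ∀ x y, splitLabel q' x = splitLabel q' y → splitLabel q x = splitLabel q y)
    (X : Fin (r + 1) → Fin (s + 1) → Finset V) (Y : Fin (r + 1) → Fin (s + 1) → Finset W)
    (hX : ∀ i j, X i j ⊆ classOf p i) (hY : ∀ i j, Y i j ⊆ classOf q j)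
    (hXs : ∀ i j x y, splitLabel p' x = splitLabel p' y → x ∈ X i j → y ∈ X i j)
    (hYs : ∀ i j x y, splitLabel q' x = splitLabel q' y → x ∈ Y i j → y ∈ Y i j)
    (B : Finset (Fin (r + 1) × Fin (s + 1)))
    (hB : ∀ ij ∈ B, ij.1 ≠ 0 ∧ ij.2 ≠ 0 ∧
      ε * (classOf p ij.1).card ≤ (X ij.1 ij.2).card ∧
      ε * (classOf q ij.2).card ≤ (Y ij.1 ij.2).card ∧
      ε < |dens f (X ij.1 ij.2) (Y ij.1 ij.2) - dens f (classOf p ij.1) (classOf q ij.2)|)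
    (hBcard : ε * r * s < B.card) :
    energy (blockLabel p q) (fun ω => f ω.1 ω.2) +
        energyGain ε * ((Fintype.card V : ℝ) * Fintype.card W) ≤
      energy (blockLabel p' q') (fun ω => f ω.1 ω.2) := by
  classical
  set F : V × W → ℝ := fun ω => f ω.1 ω.2 with hFdef
  have hF : ∀ ω, 0 ≤ F ω := fun ω => hf _ _
  have hFsum : ∑ ω, F ω = (Fintype.card V : ℝ) * Fintype.card W := by
    rw [← hsum, Fintype.sum_prod_type]
  have href : ∀ x y, blockLabel p' q' x = blockLabel p' q' y →
      blockLabel p q x = blockLabel p q y := by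
    intro x y h
    rw [blockLabel, blockLabel, Prod.mk.injEq] at h ⊢
    exact ⟨hp _ _ h.1, hq _ _ h.2⟩
  obtain ⟨N, hN⟩ : ∃ N : ℝ, N = (Fintype.card V : ℝ) * Fintype.card W := ⟨_, rfl⟩
  have hc0' : (0 : ℝ) < c := by exact_mod_cast hc0
  have he0' : (0 : ℝ) < e := by exact_mod_cast he0
  have hNle : N ≤ 4 * (r * s) * (c * e) := by
    calc N ≤ (2 * (r * c)) * (2 * (s * e)) := by rw [hN]; gcongr
      _ = _ := by ring
  set d : Fin (r + 1) × Fin (s + 1) → ℝ := fun ij => dens f (classOf p ij.1) (classOf q ij.2)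
    with hd
  have hd0 : ∀ ij, 0 ≤ d ij := fun ij => div_nonneg
    (Finset.sum_nonneg fun x _ => Finset.sum_nonneg fun y _ => hf x y) (by positivity)
  have hdense : ((B.filter fun ij => ¬ d ij ≤ 8 / ε).card : ℝ) ≤ ε * r * s / 2 := by
    have h1 : ∑ ij ∈ B.filter (fun ij => ¬ d ij ≤ 8 / ε), (8 / ε) * (c * e) ≤ N := by
      rw [hN, ← hFsum]
      refine le_trans (Finset.sum_le_sum fun ij hij => ?_)
        (sum_blocks_le (p := p) (q := q) hF (B.filter fun ij => ¬ d ij ≤ 8 / ε)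
          (fun ij => classOf p ij.1 ×ˢ classOf q ij.2) fun _ _ => subset_rfl)
      obtain ⟨hijB, hij⟩ := Finset.mem_filter.1 hij
      obtain ⟨hi, hj, -⟩ := hB ij hijB
      have h2 : ∑ ω ∈ classOf p ij.1 ×ˢ classOf q ij.2, F ω = d ij * (c * e) := by
        rw [Finset.sum_product, hd]
        simp only [_root_.dens, wSum, hc _ hi, he _ hj]
        rw [div_mul_cancel₀ _ (by positivity)]
      rw [h2]
      have := (not_le.1 hij).le
      gcongr
    rw [Finset.sum_const, nsmul_eq_mul] at h1
    have h2 := h1.trans hNle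
    rw [← mul_assoc] at h2
    have h3 := le_of_mul_le_mul_right h2 (by positivity)
    rw [← mul_div_assoc, div_le_iff₀ hε0] at h3
    linarith
  have hsparse : ε * r * s / 2 ≤ ((B.filter fun ij => d ij ≤ 8 / ε).card : ℝ) := by
    have h1 : ((B.filter fun ij => d ij ≤ 8 / ε).card : ℝ) +
        (B.filter fun ij => ¬ d ij ≤ 8 / ε).card = B.card := by
      exact_mod_cast Finset.card_filter_add_card_filter_not _
    linarith
  set gain : V × W → ℝ := fun ω => (avg (blockLabel p' q') F ω - avg (blockLabel p q) F ω) ^ 2 /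
    ((1 + avg (blockLabel p' q') F ω) * (1 + avg (blockLabel p q) F ω) ^ 2) with hgain
  have hgain0 : ∀ ω, 0 ≤ gain ω := fun ω => by
    have := avg_nonneg (π := blockLabel p q) hF ω
    have := avg_nonneg (π := blockLabel p' q') hF ω
    simp only [hgain]
    positivity
  have hblock : ∀ ij ∈ B.filter (fun ij => d ij ≤ 8 / ε),
      (ε ^ 2 * (c * e)) * (ε ^ 2 / (2 + 8 / ε) ^ 3) ≤
        ∑ ω ∈ X ij.1 ij.2 ×ˢ Y ij.1 ij.2, gain ω := by
    intro ij hij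
    obtain ⟨hijB, hijd⟩ := Finset.mem_filter.1 hij
    obtain ⟨hi, hj, hXc, hYc, hdev⟩ := hB ij hijB
    rw [hc _ hi] at hXc
    rw [he _ hj] at hYc
    have hXpos : (0 : ℝ) < (X ij.1 ij.2).card := lt_of_lt_of_le (by positivity) hXc
    have hYpos : (0 : ℝ) < (Y ij.1 ij.2).card := lt_of_lt_of_le (by positivity) hYc
    have hXne : (X ij.1 ij.2).Nonempty := Finset.card_pos.1 (by exact_mod_cast hXpos)
    have hYne : (Y ij.1 ij.2).Nonempty := Finset.card_pos.1 (by exact_mod_cast hYpos)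
    have hcard : ε ^ 2 * (c * e) ≤ ((X ij.1 ij.2 ×ˢ Y ij.1 ij.2).card : ℝ) := by
      rw [Finset.card_product, Nat.cast_mul]
      calc ε ^ 2 * (c * e) = (ε * c) * (ε * e) := by ring
        _ ≤ _ := by gcongr
    have hsat : ∀ x y, blockLabel p' q' x = blockLabel p' q' y →
        x ∈ X ij.1 ij.2 ×ˢ Y ij.1 ij.2 → y ∈ X ij.1 ij.2 ×ˢ Y ij.1 ij.2 := by
      intro x y h hx
      rw [blockLabel, blockLabel, Prod.mk.injEq] at h
      rw [Finset.mem_product] at hx ⊢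
      exact ⟨hXs _ _ _ _ h.1 hx.1, hYs _ _ _ _ h.2 hx.2⟩
    have hdens : (∑ ω ∈ X ij.1 ij.2 ×ˢ Y ij.1 ij.2, F ω) / (X ij.1 ij.2 ×ˢ Y ij.1 ij.2).card =
        dens f (X ij.1 ij.2) (Y ij.1 ij.2) := by
      rw [Finset.sum_product, Finset.card_product, _root_.dens, wSum, Nat.cast_mul]
    have h1 := sum_sq_div_lower_bound hε0 hε1 hF hsat (hXne.product hYne) (hd0 ij) hijd
      (by rw [hdens]; exact hdev)
    calc (ε ^ 2 * (c * e)) * (ε ^ 2 / (2 + 8 / ε) ^ 3)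
        ≤ (X ij.1 ij.2 ×ˢ Y ij.1 ij.2).card * (ε ^ 2 / (2 + 8 / ε) ^ 3) := by gcongr
      _ ≤ _ := h1
      _ = _ := by
        refine Finset.sum_congr rfl fun ω hω => ?_
        obtain ⟨h2, h3⟩ := Finset.mem_product.1 hω
        have h2 := mem_classOf.1 (hX _ _ h2)
        have h3 := mem_classOf.1 (hY _ _ h3)
        have h4 : avg (blockLabel p q) F ω = d ij := by
          rw [hFdef, avg_blockLabel f (h2 ▸ hi) (h3 ▸ hj), h2, h3]
        simp only [hgain, h4]
  have htotal : energyGain ε * N ≤ ∑ ω, gain ω := by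
    calc energyGain ε * N ≤ energyGain ε * (4 * (r * s) * (c * e)) := by
          have := (energyGain_pos hε0).le
          gcongr
      _ = (ε * r * s / 2) * ((ε ^ 2 * (c * e)) * (ε ^ 2 / (2 + 8 / ε) ^ 3)) := by
          rw [energyGain, div_mul_eq_div_div]
          ring
      _ ≤ (B.filter fun ij => d ij ≤ 8 / ε).card *
            ((ε ^ 2 * (c * e)) * (ε ^ 2 / (2 + 8 / ε) ^ 3)) := by gcongr
      _ = ∑ ij ∈ B.filter (fun ij => d ij ≤ 8 / ε),
            (ε ^ 2 * (c * e)) * (ε ^ 2 / (2 + 8 / ε) ^ 3) := by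
          rw [Finset.sum_const, nsmul_eq_mul]
      _ ≤ _ := Finset.sum_le_sum hblock
      _ ≤ _ := sum_blocks_le (p := p) (q := q) hgain0 _
          (fun ij => X ij.1 ij.2 ×ˢ Y ij.1 ij.2)
          fun ij _ => Finset.product_subset_product (hX _ _) (hY _ _)
  have := energy_sub_energy hF href
  rw [← hN]
  linarith

lemma splitLabel_refines {α : Type*} {r r' : ℕ} {p : V → Fin (r + 1)} {p' : V → Fin (r' + 1)}
    {a : V → α} (hE : ∀ x ∈ classOf p 0, p' x = 0)
    (ha : ∀ x y, p' x = p' y → p' x ≠ 0 → a x = a y) {x y : V}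
    (h : splitLabel p' x = splitLabel p' y) : x = y ∨ p x ≠ 0 ∧ a x = a y := by
  rw [splitLabel_eq_iff] at h
  rcases h with h | ⟨h1, h2⟩
  · exact Or.inl h
  · exact Or.inr ⟨fun h0 => h2 (hE x (mem_classOf.2 h0)), ha x y h1 h2⟩

/-- A common refinement of `p` and of the sets `X i j ⊆ classOf p i`. -/
lemma exists_balanced_refinement {ι : Type*} [Fintype ι] {r : ℕ} (p : V → Fin (r + 1))
    (X : Fin (r + 1) → ι → Finset V) (hX : ∀ i j, X i j ⊆ classOf p i) {K : ℕ} {δ : ℝ}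
    (hK : 0 < K) (hKr : (r + 1) * 2 ^ Fintype.card ι ≤ K) (hδ0 : 0 < δ) (hδ1 : δ ≤ 1 / 2)
    (hV : (K : ℝ) / δ ≤ Fintype.card V)
    (hE : ((classOf p 0).card : ℝ) + δ * Fintype.card V ≤ Fintype.card V / 2) :
    ∃ (r' : ℕ) (p' : V → Fin (r' + 1)), K ≤ r' ∧ (r' : ℝ) ≤ 2 * K / δ ∧ BalancedP p' ∧
      ((classOf p' 0).card : ℝ) ≤ (classOf p 0).card + δ * Fintype.card V ∧
      (∀ x y, splitLabel p' x = splitLabel p' y → splitLabel p x = splitLabel p y) ∧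
      ∀ i j x y, splitLabel p' x = splitLabel p' y → x ∈ X i j → y ∈ X i j := by
  classical
  obtain ⟨r', p', h1, h2, h3, h4, h5, h6⟩ := exists_balanced_chop
    (fun x => (p x, Finset.univ.filter fun j => x ∈ X (p x) j)) (classOf p 0) hK
    (by simpa using hKr) hδ0 hδ1 hV hE
  refine ⟨r', p', h1, h2, h3, h5, fun x y h => ?_, fun i j x y h hx => ?_⟩
  · rw [splitLabel_eq_iff]
    rcases splitLabel_refines h4 h6 h with h | ⟨h0, h⟩
    · exact Or.inl h
    · exact Or.inr ⟨(Prod.mk.inj h).1, h0⟩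
  · rcases splitLabel_refines h4 h6 h with rfl | ⟨h0, h⟩
    · exact hx
    · obtain ⟨h7, h8⟩ := Prod.mk.inj h
      have hpx := mem_classOf.1 (hX _ _ hx)
      have h9 : j ∈ Finset.univ.filter fun j => x ∈ X (p x) j := by simpa [hpx] using hx
      rw [h8] at h9
      simpa [← h7, hpx] using h9

lemma exists_card_classOf {r : ℕ} {p : V → Fin (r + 1)} (hp : BalancedP p)
    (hV : 0 < Fintype.card V) (h0 : ((classOf p 0).card : ℝ) ≤ Fintype.card V / 2) :
    ∃ c : ℕ, 0 < c ∧ (∀ i, i ≠ 0 → (classOf p i).card = c) ∧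
      (Fintype.card V : ℝ) ≤ 2 * (r * c) := by
  obtain ⟨c, hc⟩ : ∃ c : ℕ, ∀ i, i ≠ 0 → (classOf p i).card = c := by
    by_cases h : ∃ i : Fin (r + 1), i ≠ 0
    · obtain ⟨i, hi⟩ := h
      exact ⟨_, fun j hj => hp j i hj hi⟩
    · exact ⟨0, fun i hi => absurd ⟨i, hi⟩ h⟩
  have h1 : ((classOf p 0).card : ℝ) + r * c = Fintype.card V := by
    exact_mod_cast card_classOf_add hc
  have h2 : (0 : ℝ) < Fintype.card V := by exact_mod_cast hV
  refine ⟨c, Nat.pos_of_ne_zero ?_, hc, by linarith⟩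
  rintro rfl
  rw [Nat.cast_zero, mul_zero, add_zero] at h1
  linarith

lemma exists_energy_increment_s3 {ε δ : ℝ} (hε0 : 0 < ε) (hε1 : ε < 1) (hδ0 : 0 < δ)
    (hδ1 : δ ≤ 1 / 2) {k : ℕ} {A : Fin k → V → W → ℝ} (hA : ∀ i x y, 0 ≤ A i x y)
    (hsum : ∀ i, ∑ x, ∑ y, A i x y = (Fintype.card V : ℝ) * Fintype.card W)
    {r s K : ℕ} {p : V → Fin (r + 1)} {q : W → Fin (s + 1)} (hp : BalancedP p)
    (hq : BalancedP q) (hK : 0 < K) (hKr : (r + 1) * 2 ^ (s + 1) ≤ K)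
    (hKs : (s + 1) * 2 ^ (r + 1) ≤ K) (hV : (K : ℝ) / δ ≤ Fintype.card V)
    (hW : (K : ℝ) / δ ≤ Fintype.card W)
    (hp0 : ((classOf p 0).card : ℝ) + δ * Fintype.card V ≤ ε / 2 * Fintype.card V)
    (hq0 : ((classOf q 0).card : ℝ) + δ * Fintype.card W ≤ ε / 2 * Fintype.card W)
    (hirr : ¬ ∀ i, EpsRegularPartition (A i) ε p q) :
    ∃ (r' s' : ℕ) (p' : V → Fin (r' + 1)) (q' : W → Fin (s' + 1)),
      K ≤ r' ∧ (r' : ℝ) ≤ 2 * K / δ ∧ K ≤ s' ∧ (s' : ℝ) ≤ 2 * K / δ ∧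
      BalancedP p' ∧ BalancedP q' ∧
      ((classOf p' 0).card : ℝ) ≤ (classOf p 0).card + δ * Fintype.card V ∧
      ((classOf q' 0).card : ℝ) ≤ (classOf q 0).card + δ * Fintype.card W ∧
      ∑ i, energy (blockLabel p q) (fun ω => A i ω.1 ω.2) +
          energyGain ε * ((Fintype.card V : ℝ) * Fintype.card W) ≤
        ∑ i, energy (blockLabel p' q') (fun ω => A i ω.1 ω.2) := by
  classical
  have hK' : (0 : ℝ) < K := by exact_mod_cast hK
  have hVpos : (0 : ℝ) < Fintype.card V := lt_of_lt_of_le (by positivity) hV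
  have hWpos : (0 : ℝ) < Fintype.card W := lt_of_lt_of_le (by positivity) hW
  have hVhalf : ε / 2 * Fintype.card V ≤ Fintype.card V / 2 := by nlinarith
  have hWhalf : ε / 2 * Fintype.card W ≤ Fintype.card W / 2 := by nlinarith
  have hδV : 0 < δ * Fintype.card V := by positivity
  have hδW : 0 < δ * Fintype.card W := by positivity
  obtain ⟨i₀, hi₀⟩ := not_forall.1 hirr
  have hwit : ∀ (i : Fin (r + 1)) (j : Fin (s + 1)), ∃ (X : Finset V) (Y : Finset W),
      X ⊆ classOf p i ∧ Y ⊆ classOf q j ∧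
      (¬ EpsRegular (A i₀) ε (classOf p i) (classOf q j) →
        ε * (classOf p i).card ≤ X.card ∧ ε * (classOf q j).card ≤ Y.card ∧
        ε < |dens (A i₀) X Y - dens (A i₀) (classOf p i) (classOf q j)|) := by
    intro i j
    by_cases h : EpsRegular (A i₀) ε (classOf p i) (classOf q j)
    · exact ⟨∅, ∅, Finset.empty_subset _, Finset.empty_subset _, fun h' => absurd h h'⟩
    · have h' := h
      unfold EpsRegular at h'
      push Not at h'
      obtain ⟨X, hX, Y, hY, h1, h2, h3⟩ := h'
      exact ⟨X, Y, hX, hY, fun _ => ⟨h1, h2, h3⟩⟩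
  choose X Y hX hY hXY using hwit
  obtain ⟨r', p', h1, h2, h3, h4, h5, h6⟩ := exists_balanced_refinement p X hX hK
    (by simpa using hKr) hδ0 hδ1 hV (by linarith)
  obtain ⟨s', q', g1, g2, g3, g4, g5, g6⟩ := exists_balanced_refinement q (fun j i => Y i j)
    (fun j i => hY i j) hK (by simpa using hKs) hδ0 hδ1 hW (by linarith)
  obtain ⟨c, hc0, hc, hcV⟩ := exists_card_classOf hp (by exact_mod_cast hVpos) (by linarith)
  obtain ⟨e, he0, he, heW⟩ := exists_card_classOf hq (by exact_mod_cast hWpos) (by linarith)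
  refine ⟨r', s', p', q', h1, h2, g1, g2, h3, g3, h4, g4, ?_⟩
  have hgain := energy_add_gain_le hε0 hε1 (hA i₀) (hsum i₀) hc0 he0 hc he hcV heW h5 g5 X Y hX hY
    h6 (fun i j => g6 j i)
    (Finset.univ.filter fun ij => ij.1 ≠ 0 ∧ ij.2 ≠ 0 ∧
      ¬ EpsRegular (A i₀) ε (classOf p ij.1) (classOf q ij.2))
    (fun ij hij => by
      obtain ⟨-, hi, hj, hij⟩ := Finset.mem_filter.1 hij
      exact ⟨hi, hj, hXY _ _ hij⟩)
    (by
      by_contra hcon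
      refine hi₀ ⟨hp, hq, by nlinarith, by nlinarith, ?_⟩
      convert not_lt.1 hcon)
  have hmono : ∀ i, energy (blockLabel p q) (fun ω => A i ω.1 ω.2) ≤
      energy (blockLabel p' q') (fun ω => A i ω.1 ω.2) := fun i =>
    energy_mono (fun ω => hA i _ _) fun x y h => by
      rw [blockLabel, blockLabel, Prod.mk.injEq] at h ⊢
      exact ⟨h5 _ _ h.1, g5 _ _ h.2⟩
  rw [← Finset.add_sum_erase _ _ (Finset.mem_univ i₀),
    ← Finset.add_sum_erase (a := i₀) _
      (fun i => energy (blockLabel p' q') (fun ω => A i ω.1 ω.2)) (Finset.mem_univ i₀)]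
  have := Finset.sum_le_sum fun i (_ : i ∈ Finset.univ.erase i₀) => hmono i
  linarith

end Blocks

lemma regular_or_large_energy {ε δ : ℝ} (hε0 : 0 < ε) (hε1 : ε < 1) (hδ0 : 0 < δ)
    (hδ1 : δ ≤ 1 / 2) {L k : ℕ} (hL : 0 < L) (t : ℕ) (ht : (t + 1) * δ ≤ ε / 2) :
    ∃ R : ℕ, L ≤ R ∧ ∀ m n : ℕ, R ≤ m → R ≤ n → ∀ A : Fin k → Fin m → Fin n → ℝ,
      (∀ i x y, 0 ≤ A i x y) → (∀ i, ∑ x, ∑ y, A i x y = (m : ℝ) * n) →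
      ∃ (r s : ℕ) (p : Fin m → Fin (r + 1)) (q : Fin n → Fin (s + 1)),
        L ≤ r ∧ r ≤ R ∧ L ≤ s ∧ s ≤ R ∧
        ((∀ i, EpsRegularPartition (A i) ε p q) ∨
          BalancedP p ∧ BalancedP q ∧ ((classOf p 0).card : ℝ) ≤ (t + 1) * δ * m ∧
          ((classOf q 0).card : ℝ) ≤ (t + 1) * δ * n ∧
          t * energyGain ε * ((m : ℝ) * n) ≤
            ∑ i, energy (blockLabel p q) (fun ω => A i ω.1 ω.2)) := by
  have hfloor : ∀ {K r : ℕ}, (r : ℝ) ≤ 2 * K / δ → r ≤ ⌈2 * K / δ⌉₊ := fun h => by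
    exact_mod_cast h.trans (Nat.le_ceil _)
  have hlarge : ∀ {K m : ℕ}, ⌈2 * K / δ⌉₊ ≤ m → (K : ℝ) / δ ≤ m := fun {K m} h => by
    refine le_trans ?_ (Nat.ceil_le.1 h)
    gcongr
    linarith [Nat.cast_nonneg (α := ℝ) K]
  have hKle : ∀ K : ℕ, K ≤ ⌈2 * K / δ⌉₊ := fun K => by
    have h : (K : ℝ) ≤ 2 * K / δ := by
      rw [le_div_iff₀ hδ0]
      nlinarith [Nat.cast_nonneg (α := ℝ) K]
    exact hfloor h
  induction t with
  | zero =>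
    refine ⟨⌈2 * L / δ⌉₊, hKle L, fun m n hm hn A hA hsum => ?_⟩
    have hchop : ∀ {N : ℕ}, ⌈2 * L / δ⌉₊ ≤ N → ∃ (r : ℕ) (p : Fin N → Fin (r + 1)),
        L ≤ r ∧ r ≤ ⌈2 * L / δ⌉₊ ∧ BalancedP p ∧ ((classOf p 0).card : ℝ) ≤ δ * N := by
      intro N hN
      obtain ⟨r, p, h1, h2, h3, -, h4, -⟩ := exists_balanced_chop (V := Fin N)
        (fun _ => ()) ∅ hL (Fintype.card_unit.trans_le hL) hδ0 hδ1 (by simpa using hlarge hN) (by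
          simp only [Finset.card_empty, Nat.cast_zero, zero_add, Fintype.card_fin]
          nlinarith [Nat.cast_nonneg (α := ℝ) N])
      exact ⟨r, p, h1, hfloor h2, h3, by simpa using h4⟩
    obtain ⟨r, p, h1, h2, h3, h4⟩ := hchop hm
    obtain ⟨s, q, g1, g2, g3, g4⟩ := hchop hn
    refine ⟨r, s, p, q, h1, h2, g1, g2, Or.inr ⟨h3, g3, by simpa using h4, by simpa using g4, ?_⟩⟩
    simpa using Finset.sum_nonneg fun i _ => energy_nonneg (blockLabel p q)
      (f := fun ω => A i ω.1 ω.2) fun ω => hA i _ _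
  | succ t ih =>
    push_cast at ht
    obtain ⟨R, hLR, hR⟩ := ih (by nlinarith)
    have hRK : R ≤ (R + 1) * 2 ^ (R + 1) := by
      nlinarith [Nat.one_le_two_pow (n := R + 1)]
    refine ⟨⌈2 * ((R + 1) * 2 ^ (R + 1) : ℕ) / δ⌉₊, ?_, ?_⟩
    · exact hLR.trans (hRK.trans (hKle _))
    set K := (R + 1) * 2 ^ (R + 1) with hKdef
    intro m n hm hn A hA hsum
    have hRR := hRK.trans (hKle K)
    obtain ⟨r, s, p, q, h1, h2, h3, h4, h5⟩ := hR m n (hRR.trans hm) (hRR.trans hn) A hA hsum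
    by_cases hreg : ∀ i, EpsRegularPartition (A i) ε p q
    · exact ⟨r, s, p, q, h1, h2.trans hRR, h3, h4.trans hRR, Or.inl hreg⟩
    obtain ⟨hp, hq, hp0, hq0, hen⟩ := h5.resolve_left hreg
    have hm0 : (0 : ℝ) ≤ m := Nat.cast_nonneg m
    have hn0 : (0 : ℝ) ≤ n := Nat.cast_nonneg n
    obtain ⟨r', s', p', q', k1, k2, k3, k4, k5, k6, k7, k8, k9⟩ :=
      exists_energy_increment_s3 (K := K) hε0 hε1 hδ0 hδ1 hA (by simpa using hsum) hp hq
        (by positivity) (by rw [hKdef]; gcongr; norm_num) (by rw [hKdef]; gcongr; norm_num)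
        (by simpa using hlarge hm) (by simpa using hlarge hn)
        (by rw [Fintype.card_fin]; nlinarith) (by rw [Fintype.card_fin]; nlinarith) hreg
    rw [Fintype.card_fin] at k7 k8
    rw [Fintype.card_fin, Fintype.card_fin] at k9
    refine ⟨r', s', p', q', (hLR.trans hRK).trans k1, hfloor k2, (hLR.trans hRK).trans k3,
      hfloor k4, Or.inr ⟨k5, k6, ?_, ?_, ?_⟩⟩
    · push_cast
      linarith
    · push_cast
      linarith
    · push_cast
      linarith

lemma sum_normalizeMat {V W : Type*} [Fintype V] [Fintype W] {A : V → W → ℝ}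
    (hA : ∀ x y, 0 ≤ A x y) (hpos : 0 < matNorm A) :
    ∑ x, ∑ y, normalizeMat A x y = (Fintype.card V : ℝ) * Fintype.card W := by
  have h : matNorm A = ∑ x, ∑ y, A x y := by
    simp only [matNorm, abs_of_nonneg (hA _ _)]
  simp only [normalizeMat, ← Finset.mul_sum]
  rw [← h, div_mul_cancel₀ _ hpos.ne']

/-- **Simultaneous regularity for several matrices.**  For every `ε ∈ (0,1)` and positive
integers `L, k` there is a positive integer `M ≥ L` such that for all `m, n ≥ M` and every
sequence `A⁽¹⁾, …, A⁽ᵏ⁾` of `m × n` matrices with nonnegative entries, each having at least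
one positive entry, there is a block partition `(𝒫,𝒬)` with exceptional sets, with
`L ≤ |𝒫| ≤ M` and `L ≤ |𝒬| ≤ M`, that is simultaneously `(ε)`-regular for each `A⁽ⁱ⁾`. -/
theorem simultaneous_sparse_regularity (ε : ℝ) (hε0 : 0 < ε) (hε1 : ε < 1)
    (L k : ℕ) (hL : 0 < L) (hk : 0 < k) :
    ∃ M : ℕ, 0 < M ∧ L ≤ M ∧
      ∀ m n : ℕ, M ≤ m → M ≤ n → ∀ A : Fin k → Fin m → Fin n → ℝ,
        (∀ i x y, 0 ≤ A i x y) → (∀ i, ∃ x y, 0 < A i x y) →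
        ∃ (r s : ℕ) (p : Fin m → Fin (r + 1)) (q : Fin n → Fin (s + 1)),
          L ≤ r ∧ r ≤ M ∧ L ≤ s ∧ s ≤ M ∧
          ∀ i : Fin k, ScaledEpsRegularPartition (A i) ε p q := by
  obtain ⟨T, hT⟩ := exists_nat_gt ((k : ℝ) / energyGain ε)
  rw [div_lt_iff₀ (energyGain_pos hε0)] at hT
  have hδ : (0 : ℝ) < ε / (2 * (T + 1)) := by positivity
  have hδ1 : ε / (2 * (T + 1)) ≤ 1 / 2 := by
    rw [div_le_div_iff₀ (by positivity) (by positivity)]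
    nlinarith [Nat.cast_nonneg (α := ℝ) T]
  obtain ⟨R, hLR, hR⟩ := regular_or_large_energy (k := k) hε0 hε1 hδ hδ1 hL T
    (le_of_eq (by field_simp))
  refine ⟨R, hL.trans_le hLR, hLR, fun m n hm hn A hA hpos => ?_⟩
  have hnorm : ∀ i, 0 < matNorm (A i) := fun i => by
    obtain ⟨x, y, hxy⟩ := hpos i
    refine Finset.sum_pos' (fun x _ => Finset.sum_nonneg fun y _ => abs_nonneg _)
      ⟨x, Finset.mem_univ _, Finset.sum_pos' (fun y _ => abs_nonneg _)
        ⟨y, Finset.mem_univ _, abs_pos.2 hxy.ne'⟩⟩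
  have hN : ∀ i x y, 0 ≤ normalizeMat (A i) x y := fun i x y =>
    mul_nonneg (div_nonneg (by positivity) (hnorm i).le) (hA i x y)
  obtain ⟨r, s, p, q, h1, h2, h3, h4, h5⟩ := hR m n hm hn (fun i => normalizeMat (A i)) hN
    fun i => by simpa using sum_normalizeMat (hA i) (hnorm i)
  refine ⟨r, s, p, q, h1, h2, h3, h4, h5.resolve_right ?_⟩
  rintro ⟨-, -, -, -, hen⟩
  have hle : ∑ i, energy (blockLabel p q) (fun ω => normalizeMat (A i) ω.1 ω.2) ≤
      k * ((m : ℝ) * n) := by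
    calc _ ≤ ∑ _i : Fin k, ((m : ℝ) * n) := Finset.sum_le_sum fun i _ => by
          simpa using energy_le_card (blockLabel p q)
            (f := fun ω => normalizeMat (A i) ω.1 ω.2) fun ω => hN i _ _
      _ = _ := by simp
  have hm' : (0 : ℝ) < m := by exact_mod_cast hL.trans_le (hLR.trans hm)
  have hn' : (0 : ℝ) < n := by exact_mod_cast hL.trans_le (hLR.trans hn)
  exact absurd (hen.trans hle) (not_le.2 (by gcongr))
end
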